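/- arXiv:2302.07996 — 3 statements merged into one kernel-verified Lean document; each statement's English description precedes it below -/
import Mathlib

section
/- Let S and A be nonempty finite sets (states and actions), let P : S → A → S → ℝ be a transition kernel (P(s'|s,a) ≥ 0 and ∑_{s'} P(s'|s,a) = 1 for all s,a), let r : S → A → ℝ be a reward function, let γ ∈ ℝ, let T ≥ 1 be a finite horizon, and let π : ℝ^d → S → A → ℝ be a parametrized policy such that for every θ ∈ ℝ^d and s ∈ S, π_θ(·|s) is a strictly positive probability vector on A and θ ↦ π_θ(a|s) is differentiable for every (s,a). For a trajectory τ = (s_0, a_0, s_1, a_1, …, a_{T-1}, s_T) starting at the fixed state s_0 = s, define its probability D_θ(τ) = ∏_{t=0}^{T-1} π_θ(a_t|s_t) P(s_{t+1}|s_t,a_t), its total reward R(τ) = ∑_{t=0}^{T-1} γ^t r(s_t,a_t), and the value V(θ) = ∑_τ D_θ(τ) R(τ) (a finite sum over all trajectories of length T starting at s). Then V is differentiable in θ and its gradient satisfies ∇_θ V(θ) = ∑_τ D_θ(τ) R(τ) ∑_{t=0}^{T-1} ∇_θ log π_θ(a_t|s_t). -/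
open scoped BigOperators

noncomputable section

/-- The state at (natural-number) time `t` along a trajectory that starts at the fixed
state `s` and whose next-states (`s_1, …, s_T`) are given by `nxt`. -/
def stateAt {S : Type*} {T : ℕ} (s : S) (nxt : Fin T → S) : ℕ → S
  | 0 => s
  | t + 1 => if h : t < T then nxt ⟨t, h⟩ else s

/-- The probability `D_θ(τ) = ∏_{t=0}^{T-1} π_θ(a_t|s_t) P(s_{t+1}|s_t,a_t)` of the
length-`T` trajectory `τ` (encoded by its actions `τ.1` and next-states `τ.2`)
starting at the fixed state `s`. -/
def trajProb {S A : Type*} {T d : ℕ}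
    (pol : EuclideanSpace ℝ (Fin d) → S → A → ℝ) (P : S → A → S → ℝ) (s : S)
    (θ : EuclideanSpace ℝ (Fin d)) (τ : (Fin T → A) × (Fin T → S)) : ℝ :=
  ∏ t : Fin T,
    pol θ (stateAt s τ.2 (t : ℕ)) (τ.1 t) * P (stateAt s τ.2 (t : ℕ)) (τ.1 t) (τ.2 t)

/-- The log-derivative formula for the gradient of a finite product of positive functions. -/
theorem hasGradientAt_prod_of_pos {ι F : Type*} [Fintype ι] [NormedAddCommGroup F]
    [InnerProductSpace ℝ F] [CompleteSpace F] {f : ι → F → ℝ} {x : F}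
    (hpos : ∀ i y, 0 < f i y) (hf : ∀ i, DifferentiableAt ℝ (f i) x) :
    HasGradientAt (fun y => ∏ i, f i y)
      ((∏ i, f i x) • ∑ i, gradient (fun y => Real.log (f i y)) x) x := by
  have hexp : ∀ y, Real.exp (∑ i, Real.log (f i y)) = ∏ i, f i y := fun y => by
    simp only [Real.exp_sum, Real.exp_log (hpos _ y)]
  have h := (HasFDerivAt.fun_sum (u := Finset.univ) fun i _ =>
    ((hf i).log (hpos i x).ne').hasGradientAt.hasFDerivAt).exp
  simp only [hexp] at h
  rw [hasGradientAt_iff_hasFDerivAt, map_smul, map_sum]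
  exact h

/-- The score-function formula for the gradient of a trajectory probability. -/
theorem hasGradientAt_trajProb {S A : Type*} {T d : ℕ}
    {pol : EuclideanSpace ℝ (Fin d) → S → A → ℝ} (P : S → A → S → ℝ)
    (hpos : ∀ θ s a, 0 < pol θ s a)
    (hdiff : ∀ s a, Differentiable ℝ fun θ => pol θ s a)
    (s : S) (θ : EuclideanSpace ℝ (Fin d)) (τ : (Fin T → A) × (Fin T → S)) :
    HasGradientAt (fun θ' => trajProb pol P s θ' τ)
      (trajProb pol P s θ τ •
        ∑ t : Fin T,
          gradient (fun θ' => Real.log (pol θ' (stateAt s τ.2 (t : ℕ)) (τ.1 t))) θ) θ := by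
  have h := (hasGradientAt_prod_of_pos
    (f := fun (t : Fin T) θ' => pol θ' (stateAt s τ.2 (t : ℕ)) (τ.1 t)) (x := θ)
    (fun t θ' => hpos θ' _ _) (fun t => hdiff _ _ θ)).hasFDerivAt.mul_const
    (∏ t : Fin T, P (stateAt s τ.2 (t : ℕ)) (τ.1 t) (τ.2 t))
  simp only [trajProb, Finset.prod_mul_distrib]
  rw [hasGradientAt_iff_hasFDerivAt, mul_comm (∏ t : Fin T, pol _ _ _), mul_smul, map_smul]
  exact h

/-- **Policy gradient theorem (REINFORCE).** -/
theorem policy_gradient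
    {S A : Type*} [Fintype S] [Fintype A] [Nonempty S] [Nonempty A] {d : ℕ}
    (P : S → A → S → ℝ)
    (hP0 : ∀ s a s', 0 ≤ P s a s')
    (hP1 : ∀ s a, ∑ s', P s a s' = 1)
    (r : S → A → ℝ) (γ : ℝ) (T : ℕ) (hT : 1 ≤ T)
    (pol : EuclideanSpace ℝ (Fin d) → S → A → ℝ)
    (hpos : ∀ θ s a, 0 < pol θ s a)
    (hsum : ∀ θ s, ∑ a, pol θ s a = 1)
    (hdiff : ∀ s a, Differentiable ℝ fun θ => pol θ s a)
    (s : S)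
    (V : EuclideanSpace ℝ (Fin d) → ℝ)
    (hV : ∀ θ, V θ = ∑ τ : (Fin T → A) × (Fin T → S),
        trajProb pol P s θ τ *
          ∑ t : Fin T, γ ^ (t : ℕ) * r (stateAt s τ.2 (t : ℕ)) (τ.1 t)) :
    Differentiable ℝ V ∧
    ∀ θ, gradient V θ =
      ∑ τ : (Fin T → A) × (Fin T → S),
        (trajProb pol P s θ τ *
            ∑ t : Fin T, γ ^ (t : ℕ) * r (stateAt s τ.2 (t : ℕ)) (τ.1 t)) •
          ∑ t : Fin T,
            gradient (fun θ' => Real.log (pol θ' (stateAt s τ.2 (t : ℕ)) (τ.1 t))) θ := by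
  have h : ∀ θ, HasGradientAt V
      (∑ τ : (Fin T → A) × (Fin T → S),
        (trajProb pol P s θ τ *
            ∑ t : Fin T, γ ^ (t : ℕ) * r (stateAt s τ.2 (t : ℕ)) (τ.1 t)) •
          ∑ t : Fin T,
            gradient (fun θ' => Real.log (pol θ' (stateAt s τ.2 (t : ℕ)) (τ.1 t))) θ) θ := by
    intro θ
    rw [funext hV, hasGradientAt_iff_hasFDerivAt, map_sum]
    refine HasFDerivAt.fun_sum fun τ _ => ?_
    rw [mul_comm (trajProb _ _ _ _ _), mul_smul, map_smul]
    exact (hasGradientAt_trajProb P hpos hdiff s θ τ).hasFDerivAt.mul_const _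
  exact ⟨fun θ => (h θ).differentiableAt, fun θ => (h θ).gradient⟩
end
end

section
/- Let S and A be nonempty finite sets, P : S → A → S → ℝ a transition kernel, r : S → A → ℝ a reward function, T ≥ 1 a horizon, and π : ℝ^d → S → A → ℝ a parametrized policy with π_θ(·|s) strictly positive probability vectors differentiable in θ. Let D_θ(τ) = ∏_{t=0}^{T-1} π_θ(a_t|s_t) P(s_{t+1}|s_t,a_t) be the probability of a trajectory τ = (s_0, a_0, …, a_{T-1}, s_T) starting at a fixed state s. Then for all time indices k < t with 0 ≤ k, t ≤ T−1, ∑_τ D_θ(τ) r(s_k, a_k) ∇_θ log π_θ(a_t|s_t) = 0; that is, rewards earned strictly before time t are orthogonal in expectation to the score at time t. -/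
open scoped BigOperators

noncomputable section

/-- The first `T + 1` states of a trajectory do not depend on its last next-state. -/
theorem stateAt_snoc {S : Type*} {T : ℕ} (s : S) (nxt : Fin T → S) (x : S) {i : ℕ}
    (hi : i ≤ T) :
    stateAt s (Fin.snoc nxt x : Fin (T + 1) → S) i = stateAt s nxt i := by
  cases i with
  | zero => rfl
  | succ i =>
    have h : i < T := hi
    have h' : i < T + 1 := by omega
    simp only [stateAt, h, h', dite_true]
    exact Fin.snoc_castSucc (α := fun _ => S) x nxt ⟨i, h⟩

/-- The probability of a trajectory extended by one step. -/
theorem trajProb_snoc {S A : Type*} {T d : ℕ}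
    (pol : EuclideanSpace ℝ (Fin d) → S → A → ℝ) (P : S → A → S → ℝ) (s : S)
    (θ : EuclideanSpace ℝ (Fin d)) (τ : (Fin T → A) × (Fin T → S)) (a : A) (x : S) :
    trajProb pol P s θ
        ((Fin.snoc τ.1 a, Fin.snoc τ.2 x) : (Fin (T + 1) → A) × (Fin (T + 1) → S)) =
      trajProb pol P s θ τ * (pol θ (stateAt s τ.2 T) a * P (stateAt s τ.2 T) a x) := by
  unfold trajProb
  rw [Fin.prod_univ_castSucc]
  congr 1
  · refine Finset.prod_congr rfl fun i _ => ?_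
    simp [stateAt_snoc s τ.2 x i.2.le]
  · simp [stateAt_snoc s τ.2 x le_rfl]

/-- A sum over trajectories of length `T + 1` is an iterated sum over the trajectories of
length `T`, the last action and the last state. -/
theorem sum_trajectory_succ {S A M : Type*} [Fintype S] [Fintype A] [AddCommMonoid M] {T : ℕ}
    (f : (Fin (T + 1) → A) × (Fin (T + 1) → S) → M) :
    ∑ τ, f τ = ∑ τ : (Fin T → A) × (Fin T → S), ∑ a, ∑ x,
      f (Fin.snoc τ.1 a, Fin.snoc τ.2 x) := by
  rw [Fintype.sum_prod_type, ← (Fin.snocEquiv fun _ => A).sum_comp, Fintype.sum_prod_type_right,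
    Fintype.sum_prod_type]
  refine Finset.sum_congr rfl fun u _ => ?_
  refine Eq.trans (Finset.sum_congr rfl fun a _ => ?_) Finset.sum_comm
  rw [← (Fin.snocEquiv fun _ => S).sum_comp, Fintype.sum_prod_type_right]
  rfl

/-- The score of a differentiable family of positive probability vectors has mean zero. -/
theorem sum_smul_gradient_log_eq_zero {E A : Type*} [NormedAddCommGroup E]
    [InnerProductSpace ℝ E] [CompleteSpace E] [Fintype A] (p : E → A → ℝ)
    (hpos : ∀ θ a, 0 < p θ a) (hsum : ∀ θ, ∑ a, p θ a = 1)
    (hdiff : ∀ a, Differentiable ℝ fun θ => p θ a) (θ : E) :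
    ∑ a, p θ a • gradient (fun θ' => Real.log (p θ' a)) θ = 0 := by
  have h : ∀ a, p θ a • gradient (fun θ' => Real.log (p θ' a)) θ =
      (InnerProductSpace.toDual ℝ E).symm (fderiv ℝ (fun θ' => p θ' a) θ) := by
    intro a
    rw [gradient, fderiv.log (hdiff a θ) (hpos θ a).ne', map_smulₛₗ]
    simp [smul_smul, (hpos θ a).ne']
  have hderiv : ∑ a, fderiv ℝ (fun θ' => p θ' a) θ = 0 := by
    rw [← fderiv_fun_sum fun a _ => hdiff a θ]
    simp [hsum]
  rw [Finset.sum_congr rfl fun a _ => h a, ← map_sum, hderiv, map_zero]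

/-- **Past rewards are orthogonal to the current score.** For time indices `k < t`,
the expectation of `r(s_k,a_k) ∇_θ log π_θ(a_t|s_t)` under the trajectory distribution
is the zero vector of `ℝ^d`. -/
theorem past_rewards_orthogonal_to_score
    {S A : Type*} [Fintype S] [Fintype A] [Nonempty S] [Nonempty A] {d : ℕ}
    (P : S → A → S → ℝ)
    (hP0 : ∀ s a s', 0 ≤ P s a s')
    (hP1 : ∀ s a, ∑ s', P s a s' = 1)
    (r : S → A → ℝ) (T : ℕ) (hT : 1 ≤ T)
    (pol : EuclideanSpace ℝ (Fin d) → S → A → ℝ)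
    (hpos : ∀ θ s a, 0 < pol θ s a)
    (hsum : ∀ θ s, ∑ a, pol θ s a = 1)
    (hdiff : ∀ s a, Differentiable ℝ fun θ => pol θ s a)
    (s : S) :
    ∀ θ (k t : Fin T), (k : ℕ) < (t : ℕ) →
      ∑ τ : (Fin T → A) × (Fin T → S),
        (trajProb pol P s θ τ * r (stateAt s τ.2 (k : ℕ)) (τ.1 k)) •
          gradient (fun θ' => Real.log (pol θ' (stateAt s τ.2 (t : ℕ)) (τ.1 t))) θ
      = (0 : EuclideanSpace ℝ (Fin d)) := by
  clear hT
  intro θ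
  induction T with
  | zero => exact fun k => k.elim0
  | succ T ih =>
    intro k t hkt
    obtain ⟨k, rfl⟩ := Fin.exists_castSucc_eq.2 (Fin.ne_last_of_lt hkt)
    rw [sum_trajectory_succ]
    induction t using Fin.lastCases with
    | last =>
      refine Finset.sum_eq_zero fun τ _ => ?_
      have hscore := sum_smul_gradient_log_eq_zero (fun θ' => pol θ' (stateAt s τ.2 T))
        (fun θ' => hpos θ' _) (fun θ' => hsum θ' _) (fun a => hdiff _ a) θ
      rw [← smul_zero (trajProb pol P s θ τ * r (stateAt s τ.2 k) (τ.1 k)), ← hscore,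
        Finset.smul_sum]
      refine Finset.sum_congr rfl fun a _ => ?_
      simp only [trajProb_snoc, Fin.val_castSucc, Fin.val_last, stateAt_snoc s τ.2 _ le_rfl,
        stateAt_snoc s τ.2 _ k.2.le, Fin.snoc_castSucc, Fin.snoc_last]
      rw [← Finset.sum_smul, ← Finset.sum_mul, ← Finset.mul_sum, ← Finset.mul_sum, hP1,
        smul_smul]
      congr 1
      ring
    | cast t =>
      rw [← ih k t hkt]
      refine Finset.sum_congr rfl fun τ _ => ?_
      simp only [trajProb_snoc, Fin.val_castSucc, stateAt_snoc s τ.2 _ t.2.le,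
        stateAt_snoc s τ.2 _ k.2.le, Fin.snoc_castSucc]
      simp only [← Finset.sum_smul, ← Finset.sum_mul, ← Finset.mul_sum, hP1, mul_one, hsum]
end
end

section
/- Let S and A be nonempty finite sets, P : S → A → S → ℝ a transition kernel, r : S → A → ℝ a reward function, T ≥ 1 a horizon, and π : ℝ^d → S → A → ℝ a parametrized policy with π_θ(·|s) strictly positive probability vectors differentiable in θ. Let D_θ(τ) = ∏_{t=0}^{T-1} π_θ(a_t|s_t) P(s_{t+1}|s_t,a_t) be the probability of a trajectory τ = (s_0, a_0, …, a_{T-1}, s_T) starting at a fixed state s, let R(τ) = ∑_{t=0}^{T-1} r(s_t,a_t), let V(θ) = ∑_τ D_θ(τ) R(τ), and for each t let the reward-to-go be G_t(τ) = ∑_{k=t}^{T-1} r(s_k,a_k). Then for every function b : S → ℝ, ∇_θ V(θ) = ∑_τ D_θ(τ) ∑_{t=0}^{T-1} ∇_θ log π_θ(a_t|s_t) (G_t(τ) − b(s_t)). -/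
open scoped BigOperators

noncomputable section

theorem stateAt_cons_succ {S : Type*} {T : ℕ} (s s' : S) (nxt : Fin T → S) {k : ℕ} (hk : k < T) :
    stateAt s (Fin.cons s' nxt : Fin (T + 1) → S) (k + 1) = stateAt s' nxt k := by
  cases k with
  | zero => simp [stateAt]
  | succ k =>
    have hk' : k < T := by omega
    have h : (⟨k + 1, by omega⟩ : Fin (T + 1)) = Fin.succ ⟨k, hk'⟩ := rfl
    simp only [stateAt, hk', Nat.succ_lt_succ_iff, dite_true, h, Fin.cons_succ]

/-- The total mass of the length-`T` trajectories from `s` when the action taken at time `k` is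
weighted by `q k`. -/
def weightedMass {S A : Type*} [Fintype S] [Fintype A] (P : S → A → S → ℝ) (T : ℕ)
    (q : ℕ → S → A → ℝ) (s : S) : ℝ :=
  ∑ τ : (Fin T → A) × (Fin T → S), ∏ k : Fin T,
    (q k (stateAt s τ.2 k) (τ.1 k) * P (stateAt s τ.2 k) (τ.1 k) (τ.2 k))

theorem weightedMass_succ {S A : Type*} [Fintype S] [Fintype A] (P : S → A → S → ℝ) (T : ℕ)
    (q : ℕ → S → A → ℝ) (s : S) :
    weightedMass P (T + 1) q s =
      ∑ a, ∑ s', q 0 s a * P s a s' * weightedMass P T (fun k => q (k + 1)) s' := by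
  simp only [weightedMass, Fintype.sum_prod_type, Finset.mul_sum]
  rw [← (Fin.consEquiv fun _ : Fin (T + 1) => A).sum_comp, Fintype.sum_prod_type]
  refine Finset.sum_congr rfl fun a _ => ?_
  rw [Finset.sum_comm]
  rw [← (Fin.consEquiv fun _ : Fin (T + 1) => S).sum_comp, Fintype.sum_prod_type]
  refine Finset.sum_congr rfl fun s' _ => ?_
  rw [Finset.sum_comm]
  refine Finset.sum_congr rfl fun as _ => Finset.sum_congr rfl fun nxt _ => ?_
  change ∏ k : Fin (T + 1),
    (q k (stateAt s (Fin.cons s' nxt : Fin (T + 1) → S) k) ((Fin.cons a as : Fin (T + 1) → A) k) *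
      P (stateAt s (Fin.cons s' nxt : Fin (T + 1) → S) k) ((Fin.cons a as : Fin (T + 1) → A) k)
        ((Fin.cons s' nxt : Fin (T + 1) → S) k)) = _
  simp only [Fin.prod_univ_succ, Fin.cons_zero, Fin.cons_succ, Fin.val_succ,
    Fin.val_zero, stateAt_cons_succ s s' nxt (Fin.is_lt _)]
  rfl

theorem weightedMass_eq_one {S A : Type*} [Fintype S] [Fintype A] {P : S → A → S → ℝ}
    (hP : ∀ s a, ∑ s', P s a s' = 1) (T : ℕ) {q : ℕ → S → A → ℝ}
    (hq : ∀ k s, ∑ a, q k s a = 1) (s : S) : weightedMass P T q s = 1 := by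
  induction T generalizing q s with
  | zero => simp [weightedMass]
  | succ T ih =>
    simp [weightedMass_succ, ih fun k => hq (k + 1), ← Finset.mul_sum, hP, hq]

theorem weightedMass_eq_zero {S A : Type*} [Fintype S] [Fintype A] {P : S → A → S → ℝ}
    (hP : ∀ s a, ∑ s', P s a s' = 1) {T t : ℕ} (ht : t < T) {q : ℕ → S → A → ℝ}
    (hqt : ∀ s, ∑ a, q t s a = 0) (hq : ∀ k, t < k → ∀ s, ∑ a, q k s a = 1) (s : S) :
    weightedMass P T q s = 0 := by
  induction T generalizing t q s with
  | zero => omega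
  | succ T ih =>
    rw [weightedMass_succ]
    cases t with
    | zero =>
      simp [weightedMass_eq_one hP T fun k => hq (k + 1) k.succ_pos, ← Finset.mul_sum, hP, hqt]
    | succ t =>
      simp [ih (Nat.lt_of_succ_lt_succ ht) hqt fun k hk => hq (k + 1) (Nat.succ_lt_succ hk)]

section Score

variable {S A : Type*} {d T : ℕ} {P : S → A → S → ℝ} {pol : EuclideanSpace ℝ (Fin d) → S → A → ℝ}

/-- Directional derivative at `θ` along `v` of the score `log π_θ(a|s)`. -/
def scoreAlong (pol : EuclideanSpace ℝ (Fin d) → S → A → ℝ) (θ v : EuclideanSpace ℝ (Fin d))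
    (s : S) (a : A) : ℝ :=
  (pol θ s a)⁻¹ * fderiv ℝ (fun θ' => pol θ' s a) θ v

theorem inner_gradient_eq_fderiv (f : EuclideanSpace ℝ (Fin d) → ℝ)
    (θ v : EuclideanSpace ℝ (Fin d)) : inner ℝ (gradient f θ) v = fderiv ℝ f θ v := by
  rw [gradient, InnerProductSpace.toDual_symm_apply]

theorem inner_gradient_log_eq_scoreAlong (hpos : ∀ θ s a, 0 < pol θ s a)
    (hdiff : ∀ s a, Differentiable ℝ fun θ => pol θ s a) (θ v : EuclideanSpace ℝ (Fin d))
    (s : S) (a : A) :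
    inner ℝ (gradient (fun θ' => Real.log (pol θ' s a)) θ) v = scoreAlong pol θ v s a := by
  rw [inner_gradient_eq_fderiv, fderiv.log (hdiff s a θ) (hpos θ s a).ne']
  rfl

theorem sum_mul_scoreAlong_eq_zero [Fintype A] (hpos : ∀ θ s a, 0 < pol θ s a)
    (hsum : ∀ θ s, ∑ a, pol θ s a = 1)
    (hdiff : ∀ s a, Differentiable ℝ fun θ => pol θ s a) (θ v : EuclideanSpace ℝ (Fin d)) (s : S) :
    ∑ a, pol θ s a * scoreAlong pol θ v s a = 0 := by
  have h : fderiv ℝ (fun θ' => ∑ a, pol θ' s a) θ v = 0 := by simp [hsum]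
  rw [fderiv_fun_sum fun a _ => hdiff s a θ] at h
  simpa [scoreAlong, (hpos θ s _).ne'] using h

theorem hasFDerivAt_trajProb (hdiff : ∀ s a, Differentiable ℝ fun θ => pol θ s a) (s : S)
    (θ : EuclideanSpace ℝ (Fin d)) (τ : (Fin T → A) × (Fin T → S)) :
    HasFDerivAt (fun θ' => trajProb pol P s θ' τ)
      (∑ t : Fin T,
        (∏ k ∈ Finset.univ.erase t,
          pol θ (stateAt s τ.2 k) (τ.1 k) * P (stateAt s τ.2 k) (τ.1 k) (τ.2 k)) •
        P (stateAt s τ.2 t) (τ.1 t) (τ.2 t) •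
          fderiv ℝ (fun θ' => pol θ' (stateAt s τ.2 t) (τ.1 t)) θ) θ :=
  HasFDerivAt.finsetProd (u := Finset.univ) fun (t : Fin T) _ =>
    (hdiff (stateAt s τ.2 t) (τ.1 t) θ).hasFDerivAt.mul_const
      (P (stateAt s τ.2 t) (τ.1 t) (τ.2 t))

theorem fderiv_trajProb_apply (hpos : ∀ θ s a, 0 < pol θ s a)
    (hdiff : ∀ s a, Differentiable ℝ fun θ => pol θ s a) (s : S)
    (θ v : EuclideanSpace ℝ (Fin d)) (τ : (Fin T → A) × (Fin T → S)) :
    fderiv ℝ (fun θ' => trajProb pol P s θ' τ) θ v =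
      trajProb pol P s θ τ * ∑ t : Fin T, scoreAlong pol θ v (stateAt s τ.2 t) (τ.1 t) := by
  rw [(hasFDerivAt_trajProb hdiff s θ τ).fderiv, sum_apply, Finset.mul_sum]
  refine Finset.sum_congr rfl fun t ht => ?_
  rw [trajProb, ← Finset.prod_erase_mul _ _ ht]
  have := (hpos θ (stateAt s τ.2 t) (τ.1 t)).ne'
  simp only [scoreAlong, smul_apply, smul_eq_mul]
  field_simp

variable [Fintype S] [Fintype A]

/-- A function of the state-action pair at an earlier time, or of the state at time `t`, is
orthogonal to the score at time `t`. Both cases are covered by weights `w k` on the pairs at times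
`k ≤ t` where `w t` does not depend on the action. -/
theorem sum_trajProb_mul_prod_mul_scoreAlong_eq_zero (hP : ∀ s a, ∑ s', P s a s' = 1)
    (hpos : ∀ θ s a, 0 < pol θ s a) (hsum : ∀ θ s, ∑ a, pol θ s a = 1)
    (hdiff : ∀ s a, Differentiable ℝ fun θ => pol θ s a) (s : S) (θ v : EuclideanSpace ℝ (Fin d))
    (t : Fin T) (w : ℕ → S → A → ℝ) (c : S → ℝ) (hwt : ∀ s a, w t s a = c s)
    (hw : ∀ k, (t : ℕ) < k → ∀ s a, w k s a = 1) :
    ∑ τ : (Fin T → A) × (Fin T → S), trajProb pol P s θ τ *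
      ((∏ k : Fin T, w k (stateAt s τ.2 k) (τ.1 k)) *
        scoreAlong pol θ v (stateAt s τ.2 t) (τ.1 t)) = 0 := by
  have h := weightedMass_eq_zero hP t.is_lt
    (q := fun k s a => pol θ s a * w k s a * if k = t then scoreAlong pol θ v s a else 1)
    (fun s => by
      have := sum_mul_scoreAlong_eq_zero hpos hsum hdiff θ v s
      simp only [hwt, if_true, mul_right_comm _ (c s), ← Finset.sum_mul, this, zero_mul])
    (fun k hk s => by simp [hw k hk, hk.ne', hsum]) s
  rw [← h, weightedMass]
  refine Finset.sum_congr rfl fun τ _ => ?_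
  simp only [trajProb, Finset.prod_mul_distrib, Fin.val_inj, Finset.prod_ite_eq',
    Finset.mem_univ, if_true]
  ring

theorem sum_trajProb_mul_baseline_mul_scoreAlong_eq_zero (hP : ∀ s a, ∑ s', P s a s' = 1)
    (hpos : ∀ θ s a, 0 < pol θ s a) (hsum : ∀ θ s, ∑ a, pol θ s a = 1)
    (hdiff : ∀ s a, Differentiable ℝ fun θ => pol θ s a) (s : S) (θ v : EuclideanSpace ℝ (Fin d))
    (t : Fin T) (b : S → ℝ) :
    ∑ τ : (Fin T → A) × (Fin T → S), trajProb pol P s θ τ *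
      (b (stateAt s τ.2 t) * scoreAlong pol θ v (stateAt s τ.2 t) (τ.1 t)) = 0 := by
  simpa [Fin.val_inj] using sum_trajProb_mul_prod_mul_scoreAlong_eq_zero hP hpos hsum hdiff s θ v t
    (fun k s _ => if k = t then b s else 1) b (by simp) fun k hk _ _ => if_neg hk.ne'

theorem sum_trajProb_mul_reward_mul_scoreAlong_eq_zero (hP : ∀ s a, ∑ s', P s a s' = 1)
    (hpos : ∀ θ s a, 0 < pol θ s a) (hsum : ∀ θ s, ∑ a, pol θ s a = 1)
    (hdiff : ∀ s a, Differentiable ℝ fun θ => pol θ s a) (s : S) (θ v : EuclideanSpace ℝ (Fin d))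
    {j t : Fin T} (hjt : j < t) (r : S → A → ℝ) :
    ∑ τ : (Fin T → A) × (Fin T → S), trajProb pol P s θ τ *
      (r (stateAt s τ.2 j) (τ.1 j) * scoreAlong pol θ v (stateAt s τ.2 t) (τ.1 t)) = 0 := by
  have hjt' : (j : ℕ) < t := hjt
  simpa [Fin.val_inj] using sum_trajProb_mul_prod_mul_scoreAlong_eq_zero hP hpos hsum hdiff s θ v t
    (fun k s a => if k = j then r s a else 1) 1 (fun _ _ => if_neg hjt'.ne')
    fun k hk _ _ => if_neg (hjt'.trans hk).ne'

end Score

/-- **Reward-to-go policy gradient with a state-dependent baseline.** With undiscounted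
return `R(τ) = ∑_t r(s_t,a_t)`, value `V(θ) = ∑_τ D_θ(τ) R(τ)`, and reward-to-go
`G_t(τ) = ∑_{k=t}^{T-1} r(s_k,a_k)`, the gradient of `V` equals the expectation of
`∑_t ∇_θ log π_θ(a_t|s_t) (G_t(τ) - b(s_t))` for any baseline `b : S → ℝ`. -/
theorem reward_to_go_policy_gradient
    {S A : Type*} [Fintype S] [Fintype A] [Nonempty S] [Nonempty A] {d : ℕ}
    (P : S → A → S → ℝ)
    (hP0 : ∀ s a s', 0 ≤ P s a s')
    (hP1 : ∀ s a, ∑ s', P s a s' = 1)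
    (r : S → A → ℝ) (T : ℕ) (hT : 1 ≤ T)
    (pol : EuclideanSpace ℝ (Fin d) → S → A → ℝ)
    (hpos : ∀ θ s a, 0 < pol θ s a)
    (hsum : ∀ θ s, ∑ a, pol θ s a = 1)
    (hdiff : ∀ s a, Differentiable ℝ fun θ => pol θ s a)
    (s : S)
    (V : EuclideanSpace ℝ (Fin d) → ℝ)
    (hV : ∀ θ, V θ = ∑ τ : (Fin T → A) × (Fin T → S),
        trajProb pol P s θ τ * ∑ t : Fin T, r (stateAt s τ.2 (t : ℕ)) (τ.1 t)) :
    ∀ θ (b : S → ℝ),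
      gradient V θ =
        ∑ τ : (Fin T → A) × (Fin T → S),
          trajProb pol P s θ τ •
            ∑ t : Fin T,
              ((∑ k : Fin T, if (t : ℕ) ≤ (k : ℕ) then
                    r (stateAt s τ.2 (k : ℕ)) (τ.1 k) else 0)
                  - b (stateAt s τ.2 (t : ℕ))) •
                gradient (fun θ' => Real.log (pol θ' (stateAt s τ.2 (t : ℕ)) (τ.1 t))) θ := by
  intro θ b
  refine ext_inner_right ℝ fun v => ?_
  have hV' : V = fun θ => ∑ τ : (Fin T → A) × (Fin T → S),
      trajProb pol P s θ τ * ∑ t : Fin T, r (stateAt s τ.2 (t : ℕ)) (τ.1 t) := funext hV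
  rw [inner_gradient_eq_fderiv, hV', fderiv_fun_sum fun τ _ =>
    (hasFDerivAt_trajProb hdiff s θ τ).differentiableAt.mul_const _]
  simp only [fderiv_mul_const (hasFDerivAt_trajProb hdiff s θ _).differentiableAt, sum_inner,
    inner_smul_left,
    sum_apply, smul_apply, smul_eq_mul,
    fderiv_trajProb_apply hpos hdiff, inner_gradient_log_eq_scoreAlong hpos hdiff, conj_trivial]
  have hzero : ∑ τ : (Fin T → A) × (Fin T → S), trajProb pol P s θ τ * ∑ t : Fin T,
      ((∑ k : Fin T, if k < t then r (stateAt s τ.2 k) (τ.1 k) else 0) + b (stateAt s τ.2 t)) *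
        scoreAlong pol θ v (stateAt s τ.2 t) (τ.1 t) = 0 := by
    simp only [Finset.mul_sum (Finset.univ : Finset (Fin T))]
    rw [Finset.sum_comm]
    refine Finset.sum_eq_zero fun t _ => ?_
    simp only [add_mul, mul_add, Finset.sum_add_distrib, Finset.sum_mul, Finset.mul_sum,
      sum_trajProb_mul_baseline_mul_scoreAlong_eq_zero hP1 hpos hsum hdiff, add_zero]
    rw [Finset.sum_comm]
    refine Finset.sum_eq_zero fun k _ => ?_
    split_ifs with hkt
    · exact sum_trajProb_mul_reward_mul_scoreAlong_eq_zero hP1 hpos hsum hdiff s θ v hkt r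
    · simp
  rw [← sub_eq_zero, ← Finset.sum_sub_distrib]
  refine Eq.trans ?_ hzero
  refine Finset.sum_congr rfl fun τ _ => ?_
  rw [mul_left_comm, ← mul_sub, Finset.mul_sum, ← Finset.sum_sub_distrib]
  congr 1
  refine Finset.sum_congr rfl fun t _ => ?_
  have hsplit : ∑ k : Fin T, r (stateAt s τ.2 k) (τ.1 k) =
      (∑ k : Fin T, if (t : ℕ) ≤ k then r (stateAt s τ.2 k) (τ.1 k) else 0) +
        ∑ k : Fin T, if k < t then r (stateAt s τ.2 k) (τ.1 k) else 0 := by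
    rw [← Finset.sum_add_distrib]
    refine Finset.sum_congr rfl fun k _ => ?_
    rcases lt_or_ge k t with h | h
    · simp [h]
    · simp [h, h.not_gt]
  rw [hsplit]
  ring
end
end
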